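/- arXiv:1705.01053 — 8 statements merged into one kernel-verified Lean document; each statement's English description precedes it below -/
import Mathlib

section
/- Let a, a', b, b' ∈ ℂ and u, u', v, v' be nonzero real numbers. If the commutation relation Ṽ(b',v',λ)·Ũ(a,u,λ) = Ũ(a',u',λ)·Ṽ(b,v,λ) holds for every λ ∈ ℂ \ {0}, then the following four scalar equations hold: (i) u·u' = v·v'; (ii) b'·a − b·a' = i(u'v + uv' − u'⁻¹v⁻¹ − u⁻¹v'⁻¹); (iii) conj(b)·u' − b'·u = i(conj(a)·v' − a'·v); (iv) conj(b)·u'⁻¹ − b'·u⁻¹ = i(a'·v⁻¹ − conj(a)·v'⁻¹). -/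
/-! Lax matrices for discrete CMC surfaces (Bobenko–Romon).
`Ut a u l` is the matrix Ũ(a,u,λ) = [[a, −λu−λ⁻¹u⁻¹],[λu⁻¹+λ⁻¹u, conj a]] and
`Vt b v l` is Ṽ(b,v,λ) = [[b, −iλv+iλ⁻¹v⁻¹],[iλv⁻¹−iλ⁻¹v, conj b]]. -/

noncomputable def Ut (a : ℂ) (u : ℝ) (l : ℂ) : Matrix (Fin 2) (Fin 2) ℂ :=
  !![a, -l * (u : ℂ) - l⁻¹ * (u : ℂ)⁻¹;
     l * (u : ℂ)⁻¹ + l⁻¹ * (u : ℂ), (starRingEnd ℂ) a]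

noncomputable def Vt (b : ℂ) (v : ℝ) (l : ℂ) : Matrix (Fin 2) (Fin 2) ℂ :=
  !![b, -Complex.I * l * (v : ℂ) + Complex.I * l⁻¹ * (v : ℂ)⁻¹;
     Complex.I * l * (v : ℂ)⁻¹ - Complex.I * l⁻¹ * (v : ℂ), (starRingEnd ℂ) b]

/-- If the commutation relation Ṽ(b',v',λ)·Ũ(a,u,λ) = Ũ(a',u',λ)·Ṽ(b,v,λ) holds for all
λ ≠ 0, then the four scalar equations (i)–(iv) hold. -/
theorem commutation_scalar_equations
    (a a' b b' : ℂ) (u u' v v' : ℝ)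
    (hu : u ≠ 0) (hu' : u' ≠ 0) (hv : v ≠ 0) (hv' : v' ≠ 0)
    (hcomm : ∀ l : ℂ, l ≠ 0 → Vt b' v' l * Ut a u l = Ut a' u' l * Vt b v l) :
    u * u' = v * v' ∧
    b' * a - b * a' =
      Complex.I * ((u' : ℂ) * (v : ℂ) + (u : ℂ) * (v' : ℂ)
        - (u' : ℂ)⁻¹ * (v : ℂ)⁻¹ - (u : ℂ)⁻¹ * (v' : ℂ)⁻¹) ∧
    (starRingEnd ℂ) b * (u' : ℂ) - b' * (u : ℂ) =
      Complex.I * ((starRingEnd ℂ) a * (v' : ℂ) - a' * (v : ℂ)) ∧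
    (starRingEnd ℂ) b * (u' : ℂ)⁻¹ - b' * (u : ℂ)⁻¹ =
      Complex.I * (a' * (v : ℂ)⁻¹ - (starRingEnd ℂ) a * (v' : ℂ)⁻¹) := by
  have h1 := hcomm 1 one_ne_zero
  have hI := hcomm Complex.I Complex.I_ne_zero
  have h2 := hcomm 2 two_ne_zero
  have I2 : Complex.I * Complex.I = -1 := Complex.I_mul_I
  have p1 := congrFun (congrFun h1 0) 0
  have pI := congrFun (congrFun hI 0) 0
  have p2 := congrFun (congrFun h2 0) 0
  have q1 := congrFun (congrFun h1 0) 1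
  have qI := congrFun (congrFun hI 0) 1
  simp only [Ut, Vt, Matrix.mul_apply, Fin.sum_univ_two, Matrix.of_apply, Matrix.cons_val_zero,
    Matrix.cons_val_one, Matrix.cons_val', Matrix.cons_val_fin_one,
    inv_one, Complex.inv_I] at p1 pI p2 q1 qI
  have hu1 : (u : ℂ) ≠ 0 := by exact_mod_cast hu
  have hv1 : (v : ℂ) ≠ 0 := by exact_mod_cast hv
  have hP : Complex.I * ((v' : ℂ) * (u : ℂ)⁻¹ - (u' : ℂ) * (v : ℂ)⁻¹) = 0 := by
    generalize (u : ℂ)⁻¹ = U at *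
    generalize (v : ℂ)⁻¹ = V at *
    generalize (u' : ℂ)⁻¹ = U' at *
    generalize (v' : ℂ)⁻¹ = V' at *
    generalize Complex.I = i at *
    grind
  refine ⟨?_, ?_, ?_, ?_⟩
  · have h := (mul_eq_zero.mp hP).resolve_left Complex.I_ne_zero
    field_simp at h
    have h' : (u : ℂ) * u' = v * v' := by linear_combination -h
    exact_mod_cast h'
  all_goals
    clear hP hcomm h1 hI h2
    generalize (u : ℂ)⁻¹ = U at *
    generalize (v : ℂ)⁻¹ = V at *
    generalize (u' : ℂ)⁻¹ = U' at *
    generalize (v' : ℂ)⁻¹ = V' at *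
    generalize Complex.I = i at *
    grind
end

section
/- Let a, a', b, b' ∈ ℂ and u, u', v, v' be nonzero real numbers. The commutation relation Ṽ(b',v',λ)·Ũ(a,u,λ) = Ũ(a',u',λ)·Ṽ(b,v,λ) holds for every λ ∈ ℂ \ {0} if and only if the following three conditions hold: (i) u·u' = v·v'; (ii) the relation holds at λ = 1; and (iii) the derivative at γ = 0 of the map γ ↦ Ṽ(b',v',e^{iγ})·Ũ(a,u,e^{iγ}) − Ũ(a',u',e^{iγ})·Ṽ(b,v,e^{iγ}) (a map from ℝ to 2×2 complex matrices) vanishes. -/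
/-! Lemma on the commutation of Lax matrices (Bobenko–Romon, Lemma characterizing
the commutation relation by its value and derivative at λ = 1). -/

attribute [local instance] Matrix.normedAddCommGroup Matrix.normedSpace

theorem aux_deriv (p q : ℂ) (f : ℝ → ℂ) (hf : HasDerivAt f 0 0)
    (h : ∀ γ : ℝ, f γ = p * Complex.exp (Complex.I * γ) + q * (Complex.exp (Complex.I * γ))⁻¹) :
    p = q := by
  have hg : HasDerivAt (fun γ : ℝ => Complex.exp (Complex.I * γ)) Complex.I 0 := by
    have h1 : HasDerivAt (fun γ : ℝ => Complex.I * (γ : ℂ)) (Complex.I * 1) 0 :=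
      (Complex.ofRealCLM.hasDerivAt (x := (0 : ℝ))).const_mul Complex.I
    simpa using h1.cexp
  have hi := hg.inv (Complex.exp_ne_zero _)
  have h2 := (hg.const_mul p).add (hi.const_mul q)
  have h3 := hf.unique (h2.congr_of_eventuallyEq (Filter.Eventually.of_forall fun γ => by
    simpa using h γ))
  simp at h3
  have h4 : (p - q) * Complex.I = 0 := by linear_combination -h3
  rcases mul_eq_zero.mp h4 with h5 | h5
  · exact sub_eq_zero.mp h5
  · exact absurd h5 Complex.I_ne_zero

theorem aux_entries (a a' b b' : ℂ) (u u' v v' : ℝ) (l : ℂ) (hl : l ≠ 0) :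
    Vt b' v' l * Ut a u l - Ut a' u' l * Vt b v l =
    !![(b' * a - a' * b - Complex.I * (v' * u - (v' : ℂ)⁻¹ * (u : ℂ)⁻¹ + u' * v
          - (u' : ℂ)⁻¹ * (v : ℂ)⁻¹))
          - Complex.I * (v' * (u : ℂ)⁻¹ - u' * (v : ℂ)⁻¹) * l ^ 2
          + Complex.I * (u * (v' : ℂ)⁻¹ - v * (u' : ℂ)⁻¹) * (l⁻¹) ^ 2,
       (-b' * u - Complex.I * v' * (starRingEnd ℂ) a + Complex.I * a' * v
          + u' * (starRingEnd ℂ) b) * l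
       + (-b' * (u : ℂ)⁻¹ + Complex.I * (v' : ℂ)⁻¹ * (starRingEnd ℂ) a
          - Complex.I * a' * (v : ℂ)⁻¹ + (u' : ℂ)⁻¹ * (starRingEnd ℂ) b) * l⁻¹;
       (Complex.I * (v' : ℂ)⁻¹ * a + (starRingEnd ℂ) b' * (u : ℂ)⁻¹ - (u' : ℂ)⁻¹ * b
          - Complex.I * (starRingEnd ℂ) a' * (v : ℂ)⁻¹) * l
       + (-Complex.I * v' * a + (starRingEnd ℂ) b' * u - u' * b
          + Complex.I * (starRingEnd ℂ) a' * v) * l⁻¹,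
       ((starRingEnd ℂ) (b' * a) - (starRingEnd ℂ) (a' * b)
          + Complex.I * (v' * u - (v' : ℂ)⁻¹ * (u : ℂ)⁻¹ + u' * v - (u' : ℂ)⁻¹ * (v : ℂ)⁻¹))
          - Complex.I * (u * (v' : ℂ)⁻¹ - v * (u' : ℂ)⁻¹) * l ^ 2
          + Complex.I * (v' * (u : ℂ)⁻¹ - u' * (v : ℂ)⁻¹) * (l⁻¹) ^ 2] := by
  have hm : l * l⁻¹ = 1 := mul_inv_cancel₀ hl
  ext i j
  fin_cases i <;> fin_cases j <;> simp [Vt, Ut, Matrix.mul_apply, Fin.sum_univ_two]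
  · linear_combination (-Complex.I * (v' * u - (v' : ℂ)⁻¹ * (u : ℂ)⁻¹ + u' * v
          - (u' : ℂ)⁻¹ * (v : ℂ)⁻¹)) * hm
  · ring
  · ring
  · linear_combination (Complex.I * (v' * u - (v' : ℂ)⁻¹ * (u : ℂ)⁻¹ + u' * v
          - (u' : ℂ)⁻¹ * (v : ℂ)⁻¹)) * hm

/-- The commutation relation Ṽ(b',v',λ)Ũ(a,u,λ) = Ũ(a',u',λ)Ṽ(b,v,λ) holds for all λ ≠ 0
iff (i) uu' = vv', (ii) it holds at λ = 1, and (iii) the derivative at γ = 0 of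
γ ↦ Ṽ(b',v',e^{iγ})Ũ(a,u,e^{iγ}) − Ũ(a',u',e^{iγ})Ṽ(b,v,e^{iγ}) vanishes. -/
theorem commutation_iff_value_and_derivative_at_one
    (a a' b b' : ℂ) (u u' v v' : ℝ)
    (hu : u ≠ 0) (hu' : u' ≠ 0) (hv : v ≠ 0) (hv' : v' ≠ 0) :
    (∀ l : ℂ, l ≠ 0 → Vt b' v' l * Ut a u l = Ut a' u' l * Vt b v l) ↔
      (u * u' = v * v' ∧
       Vt b' v' 1 * Ut a u 1 = Ut a' u' 1 * Vt b v 1 ∧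
       HasDerivAt (fun γ : ℝ =>
          Vt b' v' (Complex.exp (Complex.I * γ)) * Ut a u (Complex.exp (Complex.I * γ))
          - Ut a' u' (Complex.exp (Complex.I * γ)) * Vt b v (Complex.exp (Complex.I * γ)))
        0 0) := by
  constructor
  · intro H
    refine ⟨?_, H 1 one_ne_zero, ?_⟩
    · have key : ∀ l : ℂ, l ≠ 0 → _ := fun l hl =>
        congrFun (congrFun ((aux_entries a a' b b' u u' v v' l hl).symm.trans
          (sub_eq_zero.mpr (H l hl))) 0) 0
      have h1 := key 1 one_ne_zero
      have h2 := key Complex.I Complex.I_ne_zero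
      have h3 := key 2 two_ne_zero
      simp at h1 h2 h3
      have h4 : Complex.I * ((v' : ℂ) * (u : ℂ)⁻¹ - u' * (v : ℂ)⁻¹) = 0 := by
        linear_combination (-4 / 15) * h3 + (4 / 15) * ((h1 + h2) / 2) + (1 / 15) * ((h1 - h2) / 2)
      have h5 : (v' : ℂ) * (u : ℂ)⁻¹ - u' * (v : ℂ)⁻¹ = 0 :=
        (mul_eq_zero.mp h4).resolve_left Complex.I_ne_zero
      have h6 : v' * u⁻¹ - u' * v⁻¹ = 0 := by exact_mod_cast h5
      field_simp at h6
      linarith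
    · have : (fun γ : ℝ =>
          Vt b' v' (Complex.exp (Complex.I * γ)) * Ut a u (Complex.exp (Complex.I * γ))
          - Ut a' u' (Complex.exp (Complex.I * γ)) * Vt b v (Complex.exp (Complex.I * γ)))
          = fun _ => 0 := by
        funext γ
        exact sub_eq_zero.mpr (H _ (Complex.exp_ne_zero _))
      rw [this]
      exact hasDerivAt_const _ _
  · rintro ⟨h0, h1, hd⟩ l hl
    have hA : (v' : ℂ) * (u : ℂ)⁻¹ - u' * (v : ℂ)⁻¹ = 0 := by
      have : v' * u⁻¹ - u' * v⁻¹ = 0 := by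
        field_simp
        linarith
      exact_mod_cast this
    have hB : (u : ℂ) * (v' : ℂ)⁻¹ - v * (u' : ℂ)⁻¹ = 0 := by
      have : u * v'⁻¹ - v * u'⁻¹ = 0 := by
        field_simp
        linarith
      exact_mod_cast this
    have e := (aux_entries a a' b b' u u' v v' 1 one_ne_zero).symm.trans (sub_eq_zero.mpr h1)
    have e00 := congrFun (congrFun e 0) 0
    have e01 := congrFun (congrFun e 0) 1
    have e10 := congrFun (congrFun e 1) 0
    have e11 := congrFun (congrFun e 1) 1
    have hent : ∀ i j, HasDerivAt (fun γ : ℝ =>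
          (Vt b' v' (Complex.exp (Complex.I * γ)) * Ut a u (Complex.exp (Complex.I * γ))
          - Ut a' u' (Complex.exp (Complex.I * γ)) * Vt b v (Complex.exp (Complex.I * γ))) i j)
        0 0 := fun i j => hasDerivAt_pi.mp (hasDerivAt_pi.mp hd i) j
    have d01 := aux_deriv _ _ _ (hent 0 1) (fun γ => congrFun (congrFun
      (aux_entries a a' b b' u u' v v' _ (Complex.exp_ne_zero _)) 0) 1)
    have d10 := aux_deriv _ _ _ (hent 1 0) (fun γ => congrFun (congrFun
      (aux_entries a a' b b' u u' v v' _ (Complex.exp_ne_zero _)) 1) 0)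
    rw [← sub_eq_zero, aux_entries a a' b b' u u' v v' l hl]
    rw [hA, hB] at e00 e11 ⊢
    simp only [Matrix.of_apply, Matrix.cons_val', Matrix.cons_val_zero, Matrix.cons_val_one,
      Matrix.cons_val_fin_one, Matrix.zero_apply, inv_one, mul_one, mul_zero, zero_mul,
      sub_zero, add_zero] at e00 e01 e10 e11
    ext i j
    fin_cases i <;> fin_cases j <;>
      simp only [Fin.zero_eta, Fin.mk_one, Fin.isValue, Matrix.of_apply, Matrix.cons_val',
        Matrix.cons_val_zero, Matrix.cons_val_one,
        Matrix.cons_val_fin_one, Matrix.zero_apply, mul_zero, zero_mul, sub_zero, add_zero]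
    · exact e00
    · linear_combination (l + l⁻¹) / 2 * e01 + (l - l⁻¹) / 2 * d01
    · linear_combination (l + l⁻¹) / 2 * e10 + (l - l⁻¹) / 2 * d10
    · exact e11
end

section
/- Let u, v : ℤ² → ℝ be positive functions satisfying u(m,n)·u(m,n+1) = v(m,n)·v(m+1,n) for all (m,n) ∈ ℤ². Then there exists a positive function w : ℤ² → ℝ such that u(m,n) = w(m,n)·w(m+1,n) and v(m,n) = w(m,n)·w(m,n+1) for all (m,n) ∈ ℤ². -/
/-! Factorization of edge functions on ℤ²: if the positive edge functions u (horizontal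
edges) and v (vertical edges) satisfy u·u' = v·v' on every elementary quad, i.e.
u(m,n)·u(m,n+1) = v(m,n)·v(m+1,n), then there is a positive vertex function w with
u(m,n) = w(m,n)·w(m+1,n) and v(m,n) = w(m,n)·w(m,n+1). -/

theorem line_aux (a : ℕ → ℝ) (ha : ∀ n, 0 < a n) (c : ℝ) (hc : 0 < c) :
    ∃ g : ℕ → ℝ, g 0 = c ∧ (∀ n, 0 < g n) ∧ ∀ n, a n = g n * g (n + 1) := by
  let g : ℕ → ℝ := fun n => Nat.rec c (fun k x => a k / x) n
  have hs : ∀ n, g (n + 1) = a n / g n := fun n => rfl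
  have hp : ∀ n, 0 < g n := by
    intro n
    induction n with
    | zero => exact hc
    | succ k ih => rw [hs]; exact div_pos (ha k) ih
  refine ⟨g, rfl, hp, fun n => ?_⟩
  rw [hs, mul_div_cancel₀ _ (hp n).ne']

theorem line_int (a : ℤ → ℝ) (ha : ∀ n, 0 < a n) (c : ℝ) (hc : 0 < c) :
    ∃ f : ℤ → ℝ, f 0 = c ∧ (∀ n, 0 < f n) ∧ ∀ n, a n = f n * f (n + 1) := by
  obtain ⟨g, g0, gp, hg⟩ := line_aux (fun k => a k) (fun _ => ha _) c hc
  obtain ⟨k, k0, kp, hk⟩ := line_aux (fun k => a (-(k + 1))) (fun _ => ha _) c hc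
  have key : ∀ n : ℕ, (if (0 : ℤ) ≤ -(n : ℤ) then g (-(n : ℤ)).toNat
      else k (-(-(n : ℤ))).toNat) = k n := by
    intro n
    rcases n with _ | n
    · simp [g0, k0]
    · rw [if_neg (by omega)]
      congr 1
  refine ⟨fun n => if 0 ≤ n then g n.toNat else k (-n).toNat, by simp [g0], ?_, ?_⟩
  · intro n
    dsimp only
    split_ifs
    · exact gp _
    · exact kp _
  · intro n
    dsimp only
    by_cases h : 0 ≤ n
    · lift n to ℕ using h
      rw [if_pos (by omega), if_pos (by omega)]
      exact hg n
    · obtain ⟨j, rfl⟩ : ∃ j : ℕ, n = -((j + 1 : ℕ) : ℤ) := ⟨(-n - 1).toNat, by omega⟩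
      have e : -((j + 1 : ℕ) : ℤ) + 1 = -(j : ℤ) := by push_cast; ring
      rw [e, key, key, mul_comm, ← hk j]
      push_cast
      rfl

theorem edge_factorization_exists_vertex_function
    (u v : ℤ × ℤ → ℝ) (hu : ∀ p, 0 < u p) (hv : ∀ p, 0 < v p)
    (h : ∀ m n : ℤ, u (m, n) * u (m, n + 1) = v (m, n) * v (m + 1, n)) :
    ∃ w : ℤ × ℤ → ℝ, (∀ p, 0 < w p) ∧
      (∀ m n : ℤ, u (m, n) = w (m, n) * w (m + 1, n)) ∧
      (∀ m n : ℤ, v (m, n) = w (m, n) * w (m, n + 1)) := by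
  obtain ⟨f, -, fp, hf⟩ := line_int (fun m => u (m, 0)) (fun _ => hu _) 1 one_pos
  choose w w0 wp hw using fun m => line_int (fun n => v (m, n)) (fun _ => hv _) (f m) (fp m)
  refine ⟨fun p => w p.1 p.2, fun p => wp _ _, ?_, fun m n => hw m n⟩
  intro m n
  dsimp only
  have step : ∀ n : ℤ, u (m, n) * u (m, n + 1)
      = (w m n * w (m + 1) n) * (w m (n + 1) * w (m + 1) (n + 1)) := by
    intro n
    have h1 := hw m n
    have h2 := hw (m + 1) n
    rw [h, h1, h2]
    ring
  induction n using Int.induction_on with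
  | zero => rw [w0, w0]; exact hf m
  | succ i ih =>
    have s := step i
    rw [← ih] at s
    exact mul_left_cancel₀ (hu _).ne' s
  | pred i ih =>
    have s := step (-(i : ℤ) - 1)
    rw [sub_add_cancel, ← ih] at s
    exact mul_right_cancel₀ (hu _).ne' s
end

section
/- Let U₁, U₂ be 2×2 special unitary matrices (elements of SU(2)), written U₁ = [[p₁, −conj(q₁)],[q₁, conj(p₁)]] and U₂ = [[p₂, −conj(q₂)],[q₂, conj(p₂)]]. Then there exists a real number r with U₂ − U₁ = r·(𝕜U₂ − U₁𝕜) if and only if p₁ = p₂ and (q₁ + q₂ ≠ 0 or q₁ = q₂); in particular, if U₂ − U₁ is a real multiple of 𝕜U₂ − U₁𝕜 then the diagonal entries of U₁ and U₂ coincide. -/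
/-! For U₁, U₂ ∈ SU(2) written as [[p, −conj q],[q, conj p]], the difference U₂ − U₁ is a
real multiple of 𝕜U₂ − U₁𝕜 iff p₁ = p₂ and (q₁ + q₂ ≠ 0 or q₁ = q₂); in particular the
diagonal entries then coincide. -/

noncomputable def qk : Matrix (Fin 2) (Fin 2) ℂ := !![-Complex.I, 0; 0, Complex.I]

/-- The generic element of SU(2): [[p, −conj q],[q, conj p]] with |p|² + |q|² = 1. -/
noncomputable def su2mat (p q : ℂ) : Matrix (Fin 2) (Fin 2) ℂ :=
  !![p, -(starRingEnd ℂ) q; q, (starRingEnd ℂ) p]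

theorem su2_key (p₁ q₁ p₂ q₂ : ℂ) (r : ℝ) :
    su2mat p₂ q₂ - su2mat p₁ q₁ = (r : ℂ) • (qk * su2mat p₂ q₂ - su2mat p₁ q₁ * qk) ↔
      (p₁ = p₂ ∧ q₂ - q₁ = r * Complex.I * (q₁ + q₂)) := by
  constructor
  · intro h
    have h00 := congrFun (congrFun h 0) 0
    have h10 := congrFun (congrFun h 1) 0
    simp [su2mat, qk, Matrix.mul_apply, Fin.sum_univ_two] at h00 h10
    constructor
    · have hz : (1 + r * Complex.I) * (p₂ - p₁) = 0 := by linear_combination h00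
      rcases mul_eq_zero.mp hz with h | h
      · have := congrArg Complex.re h
        simp at this
      · exact (sub_eq_zero.mp h).symm
    · linear_combination h10
  · rintro ⟨rfl, h⟩
    have hc := congrArg (starRingEnd ℂ) h
    simp at hc
    ext i j
    fin_cases i <;> fin_cases j <;>
      simp [su2mat, qk, Matrix.mul_apply, Fin.sum_univ_two]
    · right; ring
    · linear_combination -hc
    · linear_combination h
    · right; ring

theorem real_multiple_iff_diagonals_coincide
    (p₁ q₁ p₂ q₂ : ℂ)
    (h₁ : Complex.normSq p₁ + Complex.normSq q₁ = 1)
    (h₂ : Complex.normSq p₂ + Complex.normSq q₂ = 1) :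
    ((∃ r : ℝ, su2mat p₂ q₂ - su2mat p₁ q₁ =
        (r : ℂ) • (qk * su2mat p₂ q₂ - su2mat p₁ q₁ * qk)) ↔
      (p₁ = p₂ ∧ (q₁ + q₂ ≠ 0 ∨ q₁ = q₂))) ∧
    ((∃ r : ℝ, su2mat p₂ q₂ - su2mat p₁ q₁ =
        (r : ℂ) • (qk * su2mat p₂ q₂ - su2mat p₁ q₁ * qk)) →
      (su2mat p₁ q₁ 0 0 = su2mat p₂ q₂ 0 0 ∧ su2mat p₁ q₁ 1 1 = su2mat p₂ q₂ 1 1)) := by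
  simp only [su2_key]
  refine ⟨⟨?_, ?_⟩, ?_⟩
  · rintro ⟨r, hp, hq⟩
    refine ⟨hp, ?_⟩
    by_cases h : q₁ + q₂ = 0
    · right
      rw [h, mul_zero] at hq
      exact (sub_eq_zero.mp hq).symm
    · exact Or.inl h
  · rintro ⟨rfl, h | rfl⟩
    · have hn : Complex.normSq (q₁ + q₂) ≠ 0 := by simpa using h
      have hqq : Complex.normSq q₁ = Complex.normSq q₂ := by linarith
      refine ⟨((q₂ - q₁) / (q₁ + q₂)).im, rfl, ?_⟩
      have hre : ((q₂ - q₁) / (q₁ + q₂)).re = 0 := by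
        rw [Complex.div_re, ← add_div, div_eq_zero_iff]
        left
        simp only [Complex.normSq_apply] at hqq
        simp
        linarith
      have h3 := Complex.re_add_im ((q₂ - q₁) / (q₁ + q₂))
      rw [hre, Complex.ofReal_zero, zero_add] at h3
      rw [h3, div_mul_cancel₀ _ h]
    · exact ⟨0, rfl, by simp⟩
  · rintro ⟨r, rfl, -⟩
    simp [su2mat]
end

section
/- Let Φ, U : ℝ → M₂(ℂ) be maps differentiable at 0 with Φ(0) and U(0) invertible, and let Φ₁ = U·Φ (pointwise matrix product). Define, for any map Ψ : ℝ → M₂(ℂ) differentiable at 0 with Ψ(0) invertible, F̂(Ψ) = −Ψ(0)⁻¹·Ψ'(0) + (1/2)·Ψ(0)⁻¹·𝕜·Ψ(0) and N̂(Ψ) = −Ψ(0)⁻¹·𝕜·Ψ(0). Then F̂(Φ₁) − F̂(Φ) = −Φ(0)⁻¹·U(0)⁻¹·(U'(0) − (1/2)(𝕜U(0) − U(0)𝕜))·Φ(0) and N̂(Φ₁) − N̂(Φ) = −Φ(0)⁻¹·U(0)⁻¹·(𝕜U(0) − U(0)𝕜)·Φ(0). -/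
/-! The discrete Sym–Bobenko edge formulas: for a frame Φ and its shift Φ₁ = U·Φ,
F̂(Φ₁) − F̂(Φ) = −Φ(0)⁻¹U(0)⁻¹(U'(0) − ½(𝕜U(0) − U(0)𝕜))Φ(0) and
N̂(Φ₁) − N̂(Φ) = −Φ(0)⁻¹U(0)⁻¹(𝕜U(0) − U(0)𝕜)Φ(0). -/

attribute [local instance] Matrix.normedAddCommGroup Matrix.normedSpace

/-- Discrete Sym–Bobenko formula F̂(Ψ) = −Ψ(0)⁻¹Ψ'(0) + ½Ψ(0)⁻¹𝕜Ψ(0). -/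
noncomputable def Fhat (Ψ : ℝ → Matrix (Fin 2) (Fin 2) ℂ) : Matrix (Fin 2) (Fin 2) ℂ :=
  -((Ψ 0)⁻¹ * deriv Ψ 0) + ((1 : ℂ) / 2) • ((Ψ 0)⁻¹ * qk * Ψ 0)

/-- Discrete Gauss map N̂(Ψ) = −Ψ(0)⁻¹𝕜Ψ(0). -/
noncomputable def Nhat (Ψ : ℝ → Matrix (Fin 2) (Fin 2) ℂ) : Matrix (Fin 2) (Fin 2) ℂ :=
  -((Ψ 0)⁻¹ * qk * Ψ 0)

theorem edge_formulas_general
    (Φ U : ℝ → Matrix (Fin 2) (Fin 2) ℂ)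
    (hΦ : DifferentiableAt ℝ Φ 0) (hU : DifferentiableAt ℝ U 0)
    (hΦ0 : IsUnit (Φ 0)) (hU0 : IsUnit (U 0)) :
    Fhat (fun γ => U γ * Φ γ) - Fhat Φ =
      -((Φ 0)⁻¹ * (U 0)⁻¹ *
        (deriv U 0 - ((1 : ℂ) / 2) • (qk * U 0 - U 0 * qk)) * Φ 0) ∧
    Nhat (fun γ => U γ * Φ γ) - Nhat Φ =
      -((Φ 0)⁻¹ * (U 0)⁻¹ * (qk * U 0 - U 0 * qk) * Φ 0) := by
  have hd : deriv (fun γ => U γ * Φ γ) 0 = deriv U 0 * Φ 0 + U 0 * deriv Φ 0 := by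
    apply HasDerivAt.deriv
    have h1 : ∀ i j, HasDerivAt (fun γ => U γ i j) (deriv U 0 i j) 0 := fun i j =>
      hasDerivAt_pi.1 (hasDerivAt_pi.1 hU.hasDerivAt i) j
    have h2 : ∀ i j, HasDerivAt (fun γ => Φ γ i j) (deriv Φ 0 i j) 0 := fun i j =>
      hasDerivAt_pi.1 (hasDerivAt_pi.1 hΦ.hasDerivAt i) j
    refine hasDerivAt_pi.2 fun i => hasDerivAt_pi.2 fun j => ?_
    have h3 := ((h1 i 0).mul (h2 0 j)).add ((h1 i 1).mul (h2 1 j))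
    convert h3 using 1
    · funext γ
      simp [Matrix.mul_apply, Fin.sum_univ_two]
    · simp [Matrix.mul_apply, Fin.sum_univ_two]
      ring
  have hu : (U 0)⁻¹ * U 0 = 1 :=
    Matrix.nonsing_inv_mul _ ((Matrix.isUnit_iff_isUnit_det _).1 hU0)
  have hc : ∀ X : Matrix (Fin 2) (Fin 2) ℂ, (U 0)⁻¹ * (U 0 * X) = X := fun X => by
    rw [← mul_assoc, hu, one_mul]
  constructor
  · simp only [Fhat, hd, Matrix.mul_inv_rev, mul_add, mul_sub, sub_mul, mul_assoc, hc,
      Matrix.mul_smul, Matrix.smul_mul, smul_sub]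
    abel
  · simp only [Nhat, Matrix.mul_inv_rev, mul_sub, sub_mul, mul_assoc, hc]
    abel
end

section
/- Let Φ : ℝ² → M₂(ℂ) be a twice continuously differentiable map in the variables (x, γ) with Φ(x,γ) invertible for all (x,γ), and suppose ∂ₓΦ = U·Φ for a differentiable map U : ℝ² → M₂(ℂ). Then ∂ₓ(−Φ⁻¹·∂_γΦ + (1/2)·Φ⁻¹·𝕜·Φ) = Φ⁻¹·(−∂_γU + (1/2)(𝕜U − U𝕜))·Φ at every point (x,γ). -/
/-! Differential of the Sym–Bobenko formula: if ∂ₓΦ = U·Φ then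
∂ₓ(−Φ⁻¹∂_γΦ + ½Φ⁻¹𝕜Φ) = Φ⁻¹(−∂_γU + ½(𝕜U − U𝕜))Φ. -/

attribute [local instance] Matrix.normedAddCommGroup Matrix.normedSpace

/-- Partial derivative in the first variable x. -/
noncomputable def pdx (f : ℝ × ℝ → Matrix (Fin 2) (Fin 2) ℂ) (p : ℝ × ℝ) :
    Matrix (Fin 2) (Fin 2) ℂ :=
  deriv (fun t => f (t, p.2)) p.1

/-- Partial derivative in the second variable γ. -/
noncomputable def pdg (f : ℝ × ℝ → Matrix (Fin 2) (Fin 2) ℂ) (p : ℝ × ℝ) :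
    Matrix (Fin 2) (Fin 2) ℂ :=
  deriv (fun t => f (p.1, t)) p.2

theorem hasDerivAt_entries {A : ℝ → Matrix (Fin 2) (Fin 2) ℂ} {A' : Matrix (Fin 2) (Fin 2) ℂ}
    {t : ℝ} : HasDerivAt A A' t ↔ ∀ i j, HasDerivAt (fun s => A s i j) (A' i j) t := by
  have h1 : HasDerivAt A A' t ↔ ∀ i, HasDerivAt (fun s => A s i) (A' i) t :=
    hasDerivAt_pi (φ := A) (φ' := A')
  rw [h1]
  exact forall_congr' fun i => hasDerivAt_pi (φ := fun s => A s i) (φ' := A' i)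

theorem hasDerivAt_matMul {A B : ℝ → Matrix (Fin 2) (Fin 2) ℂ} {A' B' : Matrix (Fin 2) (Fin 2) ℂ}
    {t : ℝ} (hA : HasDerivAt A A' t) (hB : HasDerivAt B B' t) :
    HasDerivAt (fun s => A s * B s) (A' * B t + A t * B') t := by
  rw [hasDerivAt_entries] at *
  intro i j
  simp only [Matrix.add_apply, Matrix.mul_apply, Fin.sum_univ_two]
  have := ((hA i 0).mul (hB 0 j)).add ((hA i 1).mul (hB 1 j))
  refine this.congr_deriv ?_
  ring

theorem hasDerivAt_matInv {A : ℝ → Matrix (Fin 2) (Fin 2) ℂ} {A' : Matrix (Fin 2) (Fin 2) ℂ}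
    {t : ℝ} (hA : HasDerivAt A A' t) (hu : ∀ s, IsUnit (A s)) :
    HasDerivAt (fun s => (A s)⁻¹) (-((A t)⁻¹ * A' * (A t)⁻¹)) t := by
  have hdet : ∀ s, IsUnit (A s).det := fun s => (Matrix.isUnit_iff_isUnit_det _).1 (hu s)
  have hE := hasDerivAt_entries.1 hA
  have hd : DifferentiableAt ℝ (fun s => ((A s).det)⁻¹) t := by
    refine DifferentiableAt.inv ?_ (hdet t).ne_zero
    simp only [Matrix.det_fin_two]
    exact (((hE 0 0).mul (hE 1 1)).sub ((hE 0 1).mul (hE 1 0))).differentiableAt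
  have hex : ∀ i j, DifferentiableAt ℝ (fun s => (A s)⁻¹ i j) t := by
    intro i j
    simp only [Matrix.inv_def, Matrix.smul_apply, Ring.inverse_eq_inv', smul_eq_mul,
      Matrix.adjugate_fin_two]
    refine hd.mul ?_
    fin_cases i <;> fin_cases j <;> simp
    · exact (hE 1 1).differentiableAt
    · exact (hE 0 1).differentiableAt
    · exact (hE 1 0).differentiableAt
    · exact (hE 0 0).differentiableAt
  obtain ⟨I', hI⟩ : ∃ I', HasDerivAt (fun s => (A s)⁻¹) I' t :=
    ⟨Matrix.of fun i j => deriv (fun s => (A s)⁻¹ i j) t,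
      hasDerivAt_entries.2 fun i j => (hex i j).hasDerivAt⟩
  have h1 := hasDerivAt_matMul hI hA
  have h2 : (fun s => (A s)⁻¹ * A s) = fun _ => 1 :=
    funext fun s => Matrix.nonsing_inv_mul _ (hdet s)
  rw [h2] at h1
  have h3 := h1.unique (hasDerivAt_const t _)
  have h4 : I' = -((A t)⁻¹ * A' * (A t)⁻¹) := by
    have h5 := congrArg (· * (A t)⁻¹) h3
    simp only [add_mul, zero_mul, Matrix.mul_assoc I', Matrix.mul_nonsing_inv _ (hdet t),
      mul_one] at h5
    exact eq_neg_of_add_eq_zero_left h5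
  exact h4 ▸ hI

theorem hasDerivAt_sliceX {F : Type*} [NormedAddCommGroup F] [NormedSpace ℝ F]
    {f : ℝ × ℝ → F} {p : ℝ × ℝ}
    (hf : DifferentiableAt ℝ f p) :
    HasDerivAt (fun t => f (t, p.2)) (fderiv ℝ f p (1, 0)) p.1 :=
  HasFDerivAt.comp_hasDerivAt (f := fun t : ℝ => (t, p.2)) p.1 (l := f) hf.hasFDerivAt
    ((hasDerivAt_id p.1).prodMk (hasDerivAt_const p.1 p.2))

theorem hasDerivAt_sliceG {F : Type*} [NormedAddCommGroup F] [NormedSpace ℝ F]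
    {f : ℝ × ℝ → F} {p : ℝ × ℝ}
    (hf : DifferentiableAt ℝ f p) :
    HasDerivAt (fun t => f (p.1, t)) (fderiv ℝ f p (0, 1)) p.2 :=
  HasFDerivAt.comp_hasDerivAt (f := fun t : ℝ => (p.1, t)) p.2 (l := f) hf.hasFDerivAt
    ((hasDerivAt_const p.2 p.1).prodMk (hasDerivAt_id p.2))

theorem hasDerivAt_fderivG {F : Type*} [NormedAddCommGroup F] [NormedSpace ℝ F]
    {f : ℝ × ℝ → F} {p : ℝ × ℝ} (hf : DifferentiableAt ℝ (fderiv ℝ f) p) (v : ℝ × ℝ) :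
    HasDerivAt (fun t => fderiv ℝ f (p.1, t) v) (fderiv ℝ (fderiv ℝ f) p (0, 1) v) p.2 := by
  have h1 := (hasDerivAt_sliceG hf).clm_apply (hasDerivAt_const p.2 v)
  simpa only [map_zero, add_zero] using h1

theorem hasDerivAt_fderivX {F : Type*} [NormedAddCommGroup F] [NormedSpace ℝ F]
    {f : ℝ × ℝ → F} {p : ℝ × ℝ} (hf : DifferentiableAt ℝ (fderiv ℝ f) p) (v : ℝ × ℝ) :
    HasDerivAt (fun t => fderiv ℝ f (t, p.2) v) (fderiv ℝ (fderiv ℝ f) p (1, 0) v) p.1 := by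
  have h1 := (hasDerivAt_sliceX hf).clm_apply (hasDerivAt_const p.1 v)
  simpa only [map_zero, add_zero] using h1

theorem sym_bobenko_differential
    (Φ U : ℝ × ℝ → Matrix (Fin 2) (Fin 2) ℂ)
    (hΦ : ContDiff ℝ 2 Φ)
    (hΦinv : ∀ p, IsUnit (Φ p))
    (hU : Differentiable ℝ U)
    (hLax : ∀ p, pdx Φ p = U p * Φ p) :
    ∀ p : ℝ × ℝ,
      pdx (fun q => -((Φ q)⁻¹ * pdg Φ q) + ((1 : ℂ) / 2) • ((Φ q)⁻¹ * qk * Φ q)) p =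
        (Φ p)⁻¹ * (-(pdg U p) + ((1 : ℂ) / 2) • (qk * U p - U p * qk)) * Φ p := by
  intro p
  have hD : Differentiable ℝ Φ := hΦ.differentiable (by norm_num)
  have hDD : Differentiable ℝ (fderiv ℝ Φ) :=
    (hΦ.fderiv_right (m := 1) (by norm_num)).differentiable (by norm_num)
  have hx : ∀ q, fderiv ℝ Φ q (1, 0) = U q * Φ q := fun q =>
    (hasDerivAt_sliceX (hD q)).deriv.symm.trans (hLax q)
  have hg : ∀ q, pdg Φ q = fderiv ℝ Φ q (0, 1) := fun q => (hasDerivAt_sliceG (hD q)).deriv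
  have hUg : HasDerivAt (fun t => U (p.1, t)) (pdg U p) p.2 :=
    (hasDerivAt_sliceG (hU p)).differentiableAt.hasDerivAt
  have hsymm : fderiv ℝ (fderiv ℝ Φ) p (1, 0) (0, 1) = fderiv ℝ (fderiv ℝ Φ) p (0, 1) (1, 0) :=
    (hΦ.contDiffAt.isSymmSndFDerivAt (by simp)) _ _
  have hmix : fderiv ℝ (fderiv ℝ Φ) p (0, 1) (1, 0) = pdg U p * Φ p + U p * pdg Φ p := by
    have h1 : HasDerivAt (fun t => U (p.1, t) * Φ (p.1, t))
        (fderiv ℝ (fderiv ℝ Φ) p (0, 1) (1, 0)) p.2 :=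
      (hasDerivAt_fderivG (hDD p) (1, 0)).congr_of_eventuallyEq
        (Filter.Eventually.of_forall fun t => (hx (p.1, t)).symm)
    have h2 := hasDerivAt_matMul hUg (hasDerivAt_sliceG (hD p))
    rw [hg]
    exact h1.unique h2
  have hG : HasDerivAt (fun t => pdg Φ (t, p.2)) (pdg U p * Φ p + U p * pdg Φ p) p.1 := by
    have h1 : HasDerivAt (fun t => pdg Φ (t, p.2))
        (fderiv ℝ (fderiv ℝ Φ) p (1, 0) (0, 1)) p.1 :=
      (hasDerivAt_fderivX (hDD p) (0, 1)).congr_of_eventuallyEq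
        (Filter.Eventually.of_forall fun t => hg (t, p.2))
    rw [hsymm, hmix] at h1
    exact h1
  have hP : HasDerivAt (fun t => Φ (t, p.2)) (U p * Φ p) p.1 := hx p ▸ hasDerivAt_sliceX (hD p)
  have hI := hasDerivAt_matInv hP (fun s => hΦinv _)
  have hc := hasDerivAt_matMul (hasDerivAt_matMul hI (hasDerivAt_const p.1 qk)) hP
  have htot := (hasDerivAt_matMul hI hG).neg.add (hc.const_smul ((1 : ℂ) / 2))
  refine htot.deriv.trans ?_
  have hdet : IsUnit (Φ p).det := (Matrix.isUnit_iff_isUnit_det _).1 (hΦinv p)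
  have hcan : (Φ p)⁻¹ * (U p * Φ p) * (Φ p)⁻¹ = (Φ p)⁻¹ * U p := by
    rw [Matrix.mul_assoc, Matrix.mul_assoc, Matrix.mul_nonsing_inv _ hdet, mul_one]
  simp only [Prod.mk.eta, hcan]
  simp only [mul_add, add_mul, mul_sub, sub_mul, mul_neg, neg_mul, mul_zero, add_zero, smul_add,
    smul_sub, smul_neg, Matrix.mul_smul, Matrix.smul_mul, Matrix.mul_assoc]
  abel
end

section
/- Let p, q, r ∈ ℝ, λ₁ = e^{iπ/4}, λ₂ = e^{−iπ/4}, M = diag(e^{−iπ/4}, e^{iπ/4}), and define U(λ) = (1/2)·[[−(i/2)p, −λe^{−q/2} − λ⁻¹e^{q/2}],[λe^{q/2} + λ⁻¹e^{−q/2}, (i/2)p]] and V(λ) = (1/2)·[[(i/2)r, −iλe^{−q/2} + iλ⁻¹e^{q/2}],[iλe^{q/2} − iλ⁻¹e^{−q/2}, −(i/2)r]]. Then: (i) M⁻¹·V(λ₁)·M − V(λ₂) = e^{−q/2}·[[0, e^{iπ/4}],[−e^{−iπ/4}, 0]]; (ii) −M⁻¹·U(λ₁)·M + U(λ₂) = e^{−q/2}·[[0,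 −e^{−iπ/4}],[e^{iπ/4}, 0]]. -/
/-! The dx and dy coefficients of F⁻¹∗dF for the minimal surface in 𝕊³ (Lawson
correspondence), with λ₁ = e^{iπ/4}, λ₂ = e^{−iπ/4} and M = diag(e^{−iπ/4}, e^{iπ/4}):
M⁻¹V(λ₁)M − V(λ₂) = e^{−q/2}[[0, e^{iπ/4}],[−e^{−iπ/4}, 0]] and
−M⁻¹U(λ₁)M + U(λ₂) = e^{−q/2}[[0, −e^{−iπ/4}],[e^{iπ/4}, 0]]. -/

/-- The smooth Lax matrix U(λ), with q the conformal potential and p playing u_y. -/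
noncomputable def UsmL (p q : ℝ) (l : ℂ) : Matrix (Fin 2) (Fin 2) ℂ :=
  ((1 : ℂ) / 2) •
    !![-(Complex.I / 2) * p,
       -l * Real.exp (-q / 2) - l⁻¹ * Real.exp (q / 2);
       l * Real.exp (q / 2) + l⁻¹ * Real.exp (-q / 2),
       (Complex.I / 2) * p]

/-- The smooth Lax matrix V(λ), with r playing u_x. -/
noncomputable def VsmL (r q : ℝ) (l : ℂ) : Matrix (Fin 2) (Fin 2) ℂ :=
  ((1 : ℂ) / 2) •
    !![(Complex.I / 2) * r,
       -Complex.I * l * Real.exp (-q / 2) + Complex.I * l⁻¹ * Real.exp (q / 2);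
       Complex.I * l * Real.exp (q / 2) - Complex.I * l⁻¹ * Real.exp (-q / 2),
       -(Complex.I / 2) * r]

noncomputable def Mpi4 : Matrix (Fin 2) (Fin 2) ℂ :=
  !![Complex.exp (-(Complex.I * (Real.pi / 4))), 0;
     0, Complex.exp (Complex.I * (Real.pi / 4))]

theorem lawson_aux_sq :
    Complex.exp (Complex.I * (Real.pi / 4)) * Complex.exp (Complex.I * (Real.pi / 4))
      = Complex.I := by
  rw [← Complex.exp_add]
  refine Eq.trans ?_ Complex.exp_pi_div_two_mul_I
  congr 1
  ring

theorem lawson_aux_inv (a b : ℂ) (hab : a * b = 1) :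
    (!![b, 0; 0, a] : Matrix (Fin 2) (Fin 2) ℂ)⁻¹ = !![a, 0; 0, b] := by
  apply Matrix.inv_eq_right_inv
  ext i j
  fin_cases i <;> fin_cases j <;> simp [Matrix.mul_apply, hab, mul_comm b a]

theorem lawson_coefficients_coincide
    (p q r : ℝ) :
    Mpi4⁻¹ * VsmL r q (Complex.exp (Complex.I * (Real.pi / 4))) * Mpi4
        - VsmL r q (Complex.exp (-(Complex.I * (Real.pi / 4))))
      = (Real.exp (-q / 2)) •
          !![0, Complex.exp (Complex.I * (Real.pi / 4));
             -Complex.exp (-(Complex.I * (Real.pi / 4))), 0] ∧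
    -(Mpi4⁻¹ * UsmL p q (Complex.exp (Complex.I * (Real.pi / 4))) * Mpi4)
        + UsmL p q (Complex.exp (-(Complex.I * (Real.pi / 4))))
      = (Real.exp (-q / 2)) •
          !![0, -Complex.exp (-(Complex.I * (Real.pi / 4)));
             Complex.exp (Complex.I * (Real.pi / 4)), 0] := by
  have ha := lawson_aux_sq
  have hab : Complex.exp (Complex.I * (Real.pi / 4)) *
      Complex.exp (-(Complex.I * (Real.pi / 4))) = 1 := by
    rw [← Complex.exp_add]; simp
  unfold Mpi4 UsmL VsmL
  generalize Complex.exp (Complex.I * (Real.pi / 4)) = a at *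
  generalize Complex.exp (-(Complex.I * (Real.pi / 4))) = b at *
  have hai : a⁻¹ = b := inv_eq_of_mul_eq_one_right hab
  have hbi : b⁻¹ = a := by rw [← hai, inv_inv]
  rw [lawson_aux_inv a b hab, hai, hbi]
  generalize Real.exp (-q / 2) = E
  generalize Real.exp (q / 2) = F
  have hI := Complex.I_mul_I
  generalize Complex.I = i at *
  subst ha
  constructor
  all_goals
    ext k l
    fin_cases k <;> fin_cases l <;> simp <;> grind
end

section
/- Let Φ : ℝ → M₂(ℂ) be differentiable at 0 with Φ(0) invertible. Then the limit as γ → 0 (γ ≠ 0) of (1/sin(2γ))·(Φ(γ)⁻¹·diag(e^{−iγ}, e^{iγ})·Φ(−γ) − 𝟙) exists and equals −Φ(0)⁻¹·Φ'(0) + (1/2)·Φ(0)⁻¹·𝕜·Φ(0). -/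
/-! The Euclidean CMC net as a limit of rescaled spherical CMC nets:
lim_{γ→0, γ≠0} (1/sin(2γ))·(Φ(γ)⁻¹·diag(e^{−iγ}, e^{iγ})·Φ(−γ) − 𝟙)
  = −Φ(0)⁻¹Φ'(0) + ½Φ(0)⁻¹𝕜Φ(0). -/

attribute [local instance] Matrix.normedAddCommGroup Matrix.normedSpace

noncomputable def Mdiag (γ : ℝ) : Matrix (Fin 2) (Fin 2) ℂ :=
  !![Complex.exp (-(Complex.I * γ)), 0; 0, Complex.exp (Complex.I * γ)]

theorem Mdiag_slope : Filter.Tendsto (fun γ : ℝ => γ⁻¹ • (Mdiag γ - 1))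
    (nhdsWithin 0 {(0 : ℝ)}ᶜ) (nhds qk) := by
  have h0 : HasDerivAt (fun γ : ℝ => Complex.I * (γ : ℂ)) Complex.I 0 := by
    simpa using (Complex.ofRealCLM.hasDerivAt (x := (0 : ℝ))).const_mul Complex.I
  have h1 := h0.cexp
  have h2 := h0.neg.cexp
  rw [hasDerivAt_iff_tendsto_slope_zero] at h1 h2
  refine tendsto_pi_nhds.2 fun i => tendsto_pi_nhds.2 fun j => ?_
  fin_cases i <;> fin_cases j
  · simpa [Mdiag, qk] using h2
  · simp [Mdiag, qk]
  · simp [Mdiag, qk]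
  · simpa [Mdiag, qk] using h1

theorem Mdiag_tendsto : Filter.Tendsto Mdiag (nhdsWithin 0 {(0 : ℝ)}ᶜ) (nhds 1) := by
  have hc : Continuous Mdiag := by
    refine continuous_pi fun i => continuous_pi fun j => ?_
    fin_cases i <;> fin_cases j <;> simp [Mdiag] <;> fun_prop
  have h1 : Mdiag 0 = 1 := by
    ext i j
    fin_cases i <;> fin_cases j <;> simp [Mdiag]
  have := hc.tendsto 0
  rw [h1] at this
  exact this.mono_left nhdsWithin_le_nhds

theorem sin_slope : Filter.Tendsto (fun γ : ℝ => (Real.sin (2 * γ))⁻¹ * γ)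
    (nhdsWithin 0 {(0 : ℝ)}ᶜ) (nhds (1 / 2)) := by
  have h : HasDerivAt (fun γ : ℝ => Real.sin (2 * γ)) 2 0 := by
    simpa using ((hasDerivAt_id (0 : ℝ)).const_mul 2).sin
  rw [hasDerivAt_iff_tendsto_slope_zero] at h
  have := h.inv₀ (by norm_num)
  simpa [mul_comm] using this

theorem euclidean_limit_of_spherical_nets
    (Φ : ℝ → Matrix (Fin 2) (Fin 2) ℂ)
    (hΦ : DifferentiableAt ℝ Φ 0) (hΦ0 : IsUnit (Φ 0)) :
    Filter.Tendsto
      (fun γ : ℝ => (Real.sin (2 * γ))⁻¹ • ((Φ γ)⁻¹ * Mdiag γ * Φ (-γ) - 1))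
      (nhdsWithin 0 {(0 : ℝ)}ᶜ)
      (nhds (-((Φ 0)⁻¹ * deriv Φ 0) + ((1 : ℂ) / 2) • ((Φ 0)⁻¹ * qk * Φ 0))) := by
  have hd := hΦ.hasDerivAt
  have hcont : Filter.Tendsto Φ (nhds 0) (nhds (Φ 0)) := hΦ.continuousAt
  have hdet0 : (Φ 0).det ≠ 0 := ((Matrix.isUnit_iff_isUnit_det _).1 hΦ0).ne_zero
  have hdet : Filter.Tendsto (fun γ => (Φ γ).det) (nhds 0) (nhds (Φ 0).det) :=
    ((Continuous.matrix_det continuous_id).tendsto (Φ 0)).comp hcont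
  have hne : ∀ᶠ γ in nhdsWithin (0 : ℝ) {(0 : ℝ)}ᶜ, (Φ γ).det ≠ 0 :=
    (hdet.eventually_ne hdet0).filter_mono nhdsWithin_le_nhds
  have hinv : Filter.Tendsto (fun γ => (Φ γ)⁻¹) (nhdsWithin 0 {(0 : ℝ)}ᶜ) (nhds (Φ 0)⁻¹) := by
    have hadj : Filter.Tendsto (fun γ => (Φ γ).adjugate) (nhds 0) (nhds (Φ 0).adjugate) :=
      ((Continuous.matrix_adjugate continuous_id).tendsto (Φ 0)).comp hcont
    have := (hdet.inv₀ hdet0).smul hadj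
    simp only [Matrix.inv_def, Ring.inverse_eq_inv']
    exact this.mono_left nhdsWithin_le_nhds
  have hs1 := hasDerivAt_iff_tendsto_slope_zero.1 hd
  have hneg : Filter.Tendsto (fun γ : ℝ => -γ) (nhdsWithin 0 {(0 : ℝ)}ᶜ)
      (nhdsWithin 0 {(0 : ℝ)}ᶜ) := by
    refine tendsto_nhdsWithin_iff.2 ⟨?_, ?_⟩
    · simpa using ((continuous_neg (G := ℝ)).tendsto 0).mono_left nhdsWithin_le_nhds
    · filter_upwards [self_mem_nhdsWithin] with γ hγ
      simpa using hγ
  have hs2 := (hs1.comp hneg).neg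
  have key := sin_slope.smul (hinv.mul
    (((Mdiag_tendsto.mul hs2).add (Mdiag_slope.mul_const (Φ 0))).sub hs1))
  have hlim : (1 / 2 : ℝ) • ((Φ 0)⁻¹ * (1 * -deriv Φ 0 + qk * Φ 0 - deriv Φ 0))
      = -((Φ 0)⁻¹ * deriv Φ 0) + ((1 : ℂ) / 2) • ((Φ 0)⁻¹ * qk * Φ 0) := by
    have e : (1 / 2 : ℝ) • ((Φ 0)⁻¹ * (1 * -deriv Φ 0 + qk * Φ 0 - deriv Φ 0))
      = (1 / 2 : ℂ) • ((Φ 0)⁻¹ * (1 * -deriv Φ 0 + qk * Φ 0 - deriv Φ 0)) := by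
      ext i j
      simp
    rw [e, one_mul, mul_sub, mul_add, mul_neg, mul_assoc]
    module
  rw [← hlim]
  refine Filter.Tendsto.congr' ?_ key
  filter_upwards [hne, self_mem_nhdsWithin] with γ hγ hγ0
  have hγ0' : γ ≠ 0 := hγ0
  have hI : (Φ γ)⁻¹ * Φ γ = 1 := Matrix.nonsing_inv_mul _ (isUnit_iff_ne_zero.2 hγ)
  have h3 : Mdiag γ * -((-γ)⁻¹ • (Φ (0 + -γ) - Φ 0)) + (γ⁻¹ • (Mdiag γ - 1)) * Φ 0
      - γ⁻¹ • (Φ (0 + γ) - Φ 0) = γ⁻¹ • (Mdiag γ * Φ (-γ) - Φ γ) := by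
    rw [inv_neg, neg_smul, neg_neg, zero_add, zero_add, mul_smul_comm, smul_mul_assoc,
      mul_sub, sub_mul, one_mul]
    module
  change ((Real.sin (2 * γ))⁻¹ * γ) • ((Φ γ)⁻¹ *
    (Mdiag γ * -((-γ)⁻¹ • (Φ (0 + -γ) - Φ 0)) + (γ⁻¹ • (Mdiag γ - 1)) * Φ 0
      - γ⁻¹ • (Φ (0 + γ) - Φ 0))) = (Real.sin (2 * γ))⁻¹ • ((Φ γ)⁻¹ * Mdiag γ * Φ (-γ) - 1)
  rw [h3, mul_smul_comm, smul_smul, mul_assoc, mul_inv_cancel₀ hγ0', mul_one, mul_sub, hI,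
    mul_assoc]
end
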